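/- (Weak contraction of the transfer operator in the ‖·‖_∞ norm.) If μ ∈ L^∞ then F_*μ ∈ L^∞ and ‖F_*μ‖_∞ ≤ ‖μ‖_∞. -/

import Mathlib

open MeasureTheory ProbabilityTheory Filter ENNReal

section Setting

variable {M : Type*} {K : Type*}
variable [MetricSpace M] [CompactSpace M] [MeasurableSpace M] [BorelSpace M]
variable [MetricSpace K] [CompactSpace K] [MeasurableSpace K] [BorelSpace K]
variable [StandardBorelSpace K] [Nonempty K]

/-- Integral of a function against a signed measure, via the Jordan decomposition. -/
noncomputable def sInt {X : Type*} [MeasurableSpace X] (μ : SignedMeasure X) (g : X → ℝ) : ℝ :=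
  ∫ x, g x ∂μ.toJordanDecomposition.posPart - ∫ x, g x ∂μ.toJordanDecomposition.negPart

/-- The Wasserstein–Kantorovich-like norm `‖μ‖_W` on signed measures on `K`. -/
noncomputable def wNorm {X : Type*} [MetricSpace X] [MeasurableSpace X] (ζ : ℝ)
    (μ : SignedMeasure X) : ℝ :=
  sSup {r | ∃ g : X → ℝ, (∀ x, |g x| ≤ 1) ∧ (∀ x y, |g x - g y| ≤ dist x y ^ ζ) ∧
    r = |sInt μ g|}

open scoped Classical in
/-- A finite measure regarded as a signed measure (and `0` on non-finite measures). -/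
noncomputable def toSM {X : Type*} [MeasurableSpace X] (μ : Measure X) : SignedMeasure X :=
  if h : IsFiniteMeasure μ then @Measure.toSignedMeasure _ _ μ h else 0

/-- The restriction `μ|_γ = φ_x(γ)·π_{y*}μ_γ` of a positive finite measure on `M × K` to the
fiber over `γ`, where `φ_x = d(π_{x*}μ)/dm₁` and `μ_γ` is the conditional (Rokhlin) fiber
measure of `μ` over the first coordinate. -/
noncomputable def fiberPos (m₁ : Measure M) (μ : Measure (M × K)) [IsFiniteMeasure μ] (γ : M) :
    SignedMeasure K :=
  (μ.fst.rnDeriv m₁ γ).toReal • toSM (μ.condKernel γ)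

/-- The restriction `μ|_γ = μ⁺|_γ − μ⁻|_γ` of a signed measure on `M × K` to the fiber over
`γ`, via the Jordan decomposition. -/
noncomputable def fiberS (m₁ : Measure M) (μ : SignedMeasure (M × K)) (γ : M) :
    SignedMeasure K :=
  fiberPos m₁ μ.toJordanDecomposition.posPart γ - fiberPos m₁ μ.toJordanDecomposition.negPart γ

/-- `‖μ‖_∞ := m₁-esssup_γ ‖μ|_γ‖_W` (with values in `ℝ≥0∞`). -/
noncomputable def infNormE (ζ : ℝ) (m₁ : Measure M) (μ : SignedMeasure (M × K)) : ℝ≥0∞ :=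
  essSup (fun γ => ENNReal.ofReal (wNorm ζ (fiberS m₁ μ γ))) m₁

/-- Membership in `L^∞`: both Jordan marginals are absolutely continuous w.r.t. `m₁` and
`‖μ‖_∞ < ∞`. -/
def memLinf (ζ : ℝ) (m₁ : Measure M) (μ : SignedMeasure (M × K)) : Prop :=
  μ.toJordanDecomposition.posPart.fst ≪ m₁ ∧ μ.toJordanDecomposition.negPart.fst ≪ m₁ ∧
    infNormE ζ m₁ μ < ⊤

/-- The marginal density `φ_x = d(π_{x*}μ)/dm₁` of a signed measure on `M × K`. -/
noncomputable def signedDensity (m₁ : Measure M) (μ : SignedMeasure (M × K)) (γ : M) : ℝ :=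
  (μ.toJordanDecomposition.posPart.fst.rnDeriv m₁ γ).toReal -
    (μ.toJordanDecomposition.negPart.fst.rnDeriv m₁ γ).toReal

/-- The `ζ`-Hölder constant `H_ζ(φ)` (with values in `ℝ≥0∞`; it is `⊤` iff `φ` is not
`ζ`-Hölder). -/
noncomputable def hC {X : Type*} [MetricSpace X] (ζ : ℝ) (φ : X → ℝ) : ℝ≥0∞ :=
  ⨆ (x : X) (y : X) (_ : x ≠ y), ENNReal.ofReal (|φ x - φ y| / dist x y ^ ζ)

/-- The `ζ`-Hölder norm `|φ|_ζ = sup|φ| + H_ζ(φ)` (with values in `ℝ≥0∞`). -/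
noncomputable def hNormE {X : Type*} [MetricSpace X] (ζ : ℝ) (φ : X → ℝ) : ℝ≥0∞ :=
  (⨆ x : X, ENNReal.ofReal |φ x|) + hC ζ φ

/-- Membership in `S^∞`: `μ ∈ L^∞` and the marginal density has a `ζ`-Hölder version. -/
def memSinf (ζ : ℝ) (m₁ : Measure M) (μ : SignedMeasure (M × K)) : Prop :=
  memLinf ζ m₁ μ ∧ ∃ φ : M → ℝ, φ =ᵐ[m₁] signedDensity m₁ μ ∧ hC ζ φ < ⊤

/-- The `S^∞` norm `‖μ‖_{S^∞} = |φ_x|_ζ + ‖μ‖_∞` (infimum of `|·|_ζ` over versions of the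
marginal density; with values in `ℝ≥0∞`). -/
noncomputable def sNormE (ζ : ℝ) (m₁ : Measure M) (μ : SignedMeasure (M × K)) : ℝ≥0∞ :=
  (⨅ (φ : M → ℝ) (_ : φ =ᵐ[m₁] signedDensity m₁ μ), hNormE ζ φ) + infNormE ζ m₁ μ

/-- The transfer (Perron–Frobenius) operator of `f` with respect to `m₁`:
`P_f φ = d(f_*(φ·m₁))/dm₁`. -/
noncomputable def Pf {X : Type*} [MeasurableSpace X] (m₁ : Measure X) (f : X → X)
    (φ : X → ℝ) : X → ℝ := fun γ =>
  (((m₁.withDensity fun x => ENNReal.ofReal (φ x)).map f).rnDeriv m₁ γ).toReal -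
    (((m₁.withDensity fun x => ENNReal.ofReal (-φ x)).map f).rnDeriv m₁ γ).toReal

end Setting

lemma aux_jordan {X : Type*} [MeasurableSpace X] (σ : SignedMeasure X) (p q : Measure X)
    [IsFiniteMeasure p] [IsFiniteMeasure q] (h : σ = p.toSignedMeasure - q.toSignedMeasure) :
    σ.toJordanDecomposition.posPart + q = σ.toJordanDecomposition.negPart + p := by
  have h1 := σ.toSignedMeasure_toJordanDecomposition
  rw [JordanDecomposition.toSignedMeasure] at h1
  rw [← Measure.toSignedMeasure_eq_toSignedMeasure_iff, Measure.toSignedMeasure_add,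
    Measure.toSignedMeasure_add]
  have h2 := h1.trans h
  rw [sub_eq_sub_iff_add_eq_add] at h2
  rw [h2, add_comm]

lemma aux_le {X : Type*} [MeasurableSpace X] (a b p q : Measure X)
    (hab : a ⟂ₘ b) (h : a + q = b + p) : a ≤ p := by
  obtain ⟨u, hu, h1, h2⟩ := hab
  refine Measure.le_iff.2 fun A hA => ?_
  have e : a A = a (A ∩ uᶜ) := by
    refine le_antisymm ?_ (measure_mono Set.inter_subset_left)
    calc a A ≤ a (A ∩ uᶜ ∪ u) := measure_mono (by
          intro x hx; by_cases hxu : x ∈ u <;> simp [hx, hxu])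
      _ ≤ a (A ∩ uᶜ) + a u := measure_union_le _ _
      _ = a (A ∩ uᶜ) := by rw [h1, add_zero]
  have h3 : b (A ∩ uᶜ) = 0 := measure_mono_null Set.inter_subset_right h2
  have h4 := congrArg (fun m : Measure X => m (A ∩ uᶜ)) h
  simp only [Measure.add_apply, h3, zero_add] at h4
  calc a A = a (A ∩ uᶜ) := e
    _ ≤ a (A ∩ uᶜ) + q (A ∩ uᶜ) := le_self_add
    _ = p (A ∩ uᶜ) := h4
    _ ≤ p A := measure_mono Set.inter_subset_left

lemma aux_int {X : Type*} [MeasurableSpace X] (p : Measure X) [IsFiniteMeasure p] {g : X → ℝ}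
    (hg : Measurable g) (hb : ∀ x, |g x| ≤ 1) : Integrable g p :=
  Integrable.of_bound hg.aestronglyMeasurable 1 (Eventually.of_forall hb)

lemma aux_sInt {X : Type*} [MeasurableSpace X] (σ : SignedMeasure X) (p q : Measure X)
    [IsFiniteMeasure p] [IsFiniteMeasure q] (h : σ = p.toSignedMeasure - q.toSignedMeasure)
    {g : X → ℝ} (hg : Measurable g) (hb : ∀ x, |g x| ≤ 1) :
    sInt σ g = ∫ x, g x ∂p - ∫ x, g x ∂q := by
  have h1 := aux_jordan σ p q h
  have h2 := congrArg (fun m : Measure X => ∫ x, g x ∂m) h1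
  rw [integral_add_measure (aux_int _ hg hb) (aux_int _ hg hb),
    integral_add_measure (aux_int _ hg hb) (aux_int _ hg hb)] at h2
  unfold sInt
  linarith

lemma aux_map {X Y : Type*} [MeasurableSpace X] [MeasurableSpace Y] (μ : SignedMeasure X)
    {F : X → Y} (hF : Measurable F) :
    μ.map F = (μ.toJordanDecomposition.posPart.map F).toSignedMeasure -
      (μ.toJordanDecomposition.negPart.map F).toSignedMeasure := by
  ext A hA
  rw [VectorMeasure.map_apply _ hF hA, Measure.toSignedMeasure_sub_apply hA,
    map_measureReal_apply hF hA, map_measureReal_apply hF hA]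
  conv_lhs => rw [← μ.toSignedMeasure_toJordanDecomposition, JordanDecomposition.toSignedMeasure]
  rw [Measure.toSignedMeasure_sub_apply (hF hA)]

lemma aux_sInt_map {X Y : Type*} [MeasurableSpace X] [MeasurableSpace Y] (μ : SignedMeasure X)
    {F : X → Y} (hF : Measurable F) {g : Y → ℝ} (hg : Measurable g) (hb : ∀ x, |g x| ≤ 1) :
    sInt (μ.map F) g = sInt μ (fun x => g (F x)) := by
  rw [aux_sInt _ _ _ (aux_map μ hF) hg hb, sInt, integral_map hF.aemeasurable
    hg.aestronglyMeasurable, integral_map hF.aemeasurable hg.aestronglyMeasurable]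

lemma aux_bound {X : Type*} [MeasurableSpace X] (σ : SignedMeasure X) (g : X → ℝ) (c : ℝ)
    (hb : ∀ x, |g x| ≤ c) : |sInt σ g| ≤ c * (σ.toJordanDecomposition.posPart.real Set.univ +
      σ.toJordanDecomposition.negPart.real Set.univ) := by
  have h1 := norm_integral_le_of_norm_le_const (μ := σ.toJordanDecomposition.posPart)
    (f := g) (C := c) (Eventually.of_forall hb)
  have h2 := norm_integral_le_of_norm_le_const (μ := σ.toJordanDecomposition.negPart)
    (f := g) (C := c) (Eventually.of_forall hb)
  unfold sInt
  rw [Real.norm_eq_abs] at h1 h2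
  have := abs_sub (∫ x, g x ∂σ.toJordanDecomposition.posPart)
    (∫ x, g x ∂σ.toJordanDecomposition.negPart)
  linarith

lemma aux_le_wNorm {X : Type*} [MetricSpace X] [MeasurableSpace X] (ζ : ℝ) (σ : SignedMeasure X)
    (g : X → ℝ) (hb : ∀ x, |g x| ≤ 1) (hh : ∀ x y, |g x - g y| ≤ dist x y ^ ζ) :
    |sInt σ g| ≤ wNorm ζ σ := by
  refine le_csSup ⟨1 * (σ.toJordanDecomposition.posPart.real Set.univ +
      σ.toJordanDecomposition.negPart.real Set.univ), ?_⟩ ⟨g, hb, hh, rfl⟩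
  rintro r ⟨g', hb', -, rfl⟩
  exact aux_bound σ g' 1 hb'

lemma aux_cont {X : Type*} [MetricSpace X] {ζ : ℝ} (hζ : 0 < ζ) {g : X → ℝ}
    (hh : ∀ x y, |g x - g y| ≤ dist x y ^ ζ) : Continuous g := by
  rw [continuous_iff_continuousAt]
  intro x
  rw [ContinuousAt, tendsto_iff_dist_tendsto_zero]
  refine squeeze_zero (fun _ => dist_nonneg) (g := fun y => dist y x ^ ζ)
    (fun y => by rw [Real.dist_eq]; exact hh y x) ?_
  have : Continuous fun y => dist y x ^ ζ :=
    (continuous_id.dist continuous_const).rpow_const (fun _ => Or.inr hζ.le)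
  have h := this.tendsto x
  simpa [Real.zero_rpow hζ.ne'] using h

lemma aux_sInt_cont {X : Type*} [MetricSpace X] [CompactSpace X] [MeasurableSpace X] [BorelSpace X]
    (σ : SignedMeasure X) : Continuous fun g : C(X, ℝ) => sInt σ g := by
  have hi : ∀ (p : Measure X) [IsFiniteMeasure p] (g : C(X, ℝ)), Integrable g p := fun p _ g =>
    Integrable.of_bound g.continuous.measurable.aestronglyMeasurable ‖g‖
      (Eventually.of_forall g.norm_coe_le_norm)
  refine (LipschitzWith.of_dist_le' (K := σ.toJordanDecomposition.posPart.real Set.univ +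
      σ.toJordanDecomposition.negPart.real Set.univ) fun g g' => ?_).continuous
  have : sInt σ g - sInt σ g' = sInt σ (g - g') := by
    simp only [sInt, Pi.sub_apply]
    rw [integral_sub (hi _ _) (hi _ _), integral_sub (hi _ _) (hi _ _)]
    ring
  rw [Real.dist_eq, this, mul_comm]
  exact aux_bound _ _ _ fun x => by
    have := ContinuousMap.dist_apply_le_dist (f := g) (g := g') x
    simpa [Real.dist_eq] using this

section Aux

variable {M : Type*} {K : Type*}
variable [MetricSpace M] [CompactSpace M] [MeasurableSpace M] [BorelSpace M]
variable [MetricSpace K] [CompactSpace K] [MeasurableSpace K] [BorelSpace K]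
variable [StandardBorelSpace K] [Nonempty K]

lemma aux_fiberPos (m₁ : Measure M) (μ : Measure (M × K)) [IsFiniteMeasure μ] (γ : M) :
    fiberPos m₁ μ γ = ((μ.fst.rnDeriv m₁ γ).toNNReal • μ.condKernel γ).toSignedMeasure := by
  rw [fiberPos, toSM, dif_pos (by infer_instance), Measure.toSignedMeasure_smul]
  rfl

lemma aux_sInt_fiber (m₁ : Measure M) (μ : SignedMeasure (M × K)) (γ : M) {g : K → ℝ}
    (hg : Measurable g) (hb : ∀ x, |g x| ≤ 1) :
    sInt (fiberS m₁ μ γ) g =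
      (μ.toJordanDecomposition.posPart.fst.rnDeriv m₁ γ).toReal *
        ∫ z, g z ∂μ.toJordanDecomposition.posPart.condKernel γ -
      (μ.toJordanDecomposition.negPart.fst.rnDeriv m₁ γ).toReal *
        ∫ z, g z ∂μ.toJordanDecomposition.negPart.condKernel γ := by
  rw [aux_sInt (fiberS m₁ μ γ) _ _ (by rw [fiberS, aux_fiberPos, aux_fiberPos]) hg hb,
    integral_smul_nnreal_measure, integral_smul_nnreal_measure]
  rfl

lemma aux_disint (m₁ : Measure M) [IsFiniteMeasure m₁] (μ : Measure (M × K)) [IsFiniteMeasure μ]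
    (hμ : μ.fst ≪ m₁) {h : M × K → ℝ} (hh : Measurable h) (hb : ∀ x, |h x| ≤ 1) :
    Integrable (fun x => (μ.fst.rnDeriv m₁ x).toReal * ∫ z, h (x, z) ∂μ.condKernel x) m₁ ∧
    ∫ x, (μ.fst.rnDeriv m₁ x).toReal * ∫ z, h (x, z) ∂μ.condKernel x ∂m₁ = ∫ p, h p ∂μ := by
  constructor
  · have : Integrable (fun x => ∫ z, h (x, z) ∂μ.condKernel x) μ.fst := by
      refine Integrable.of_bound
        (hh.aestronglyMeasurable (μ := μ)).integral_condKernel 1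
        (Eventually.of_forall fun x => ?_)
      have := norm_integral_le_of_norm_le_const (μ := μ.condKernel x)
        (f := fun z => h (x, z)) (C := 1) (Eventually.of_forall fun z => hb _)
      simpa using this
    exact (integrable_rnDeriv_smul_iff hμ).2 this
  · rw [← Measure.integral_condKernel (aux_int μ hh hb)]
    exact integral_rnDeriv_smul hμ

lemma aux_disintS (m₁ : Measure M) [IsFiniteMeasure m₁] (μ : SignedMeasure (M × K))
    (h1 : μ.toJordanDecomposition.posPart.fst ≪ m₁)
    (h2 : μ.toJordanDecomposition.negPart.fst ≪ m₁)
    {h : M × K → ℝ} (hh : Measurable h) (hb : ∀ x, |h x| ≤ 1) :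
    Integrable (fun x => sInt (fiberS m₁ μ x) (fun z => h (x, z))) m₁ ∧
    ∫ x, sInt (fiberS m₁ μ x) (fun z => h (x, z)) ∂m₁ = sInt μ h := by
  have e : (fun x => sInt (fiberS m₁ μ x) (fun z => h (x, z))) = fun x =>
      (μ.toJordanDecomposition.posPart.fst.rnDeriv m₁ x).toReal *
        ∫ z, h (x, z) ∂μ.toJordanDecomposition.posPart.condKernel x -
      (μ.toJordanDecomposition.negPart.fst.rnDeriv m₁ x).toReal *
        ∫ z, h (x, z) ∂μ.toJordanDecomposition.negPart.condKernel x := by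
    funext x
    exact aux_sInt_fiber m₁ μ x (hh.comp measurable_prodMk_left) (fun z => hb _)
  have a1 := aux_disint m₁ _ h1 hh hb
  have a2 := aux_disint m₁ _ h2 hh hb
  rw [e]
  refine ⟨a1.1.sub a2.1, ?_⟩
  rw [integral_sub a1.1 a2.1, a1.2, a2.2, sInt]

lemma aux_sInt_const_mul {X : Type*} [MeasurableSpace X] (σ : SignedMeasure X) (c : ℝ)
    (g : X → ℝ) : sInt σ (fun x => c * g x) = c * sInt σ g := by
  simp only [sInt, integral_const_mul]
  ring

lemma aux_ae (ζ : ℝ) (hζ0 : 0 < ζ) (m₁ : Measure M) [IsProbabilityMeasure m₁]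
    (f : M → M) (hf : Measurable f) (hfinv : m₁.map f = m₁)
    (G : M × K → K) (hG : Measurable G)
    (hGc : ∀ᵐ x ∂m₁, ∀ z₁ z₂ : K, dist (G (x, z₁)) (G (x, z₂)) ≤ dist z₁ z₂)
    (μ ν : SignedMeasure (M × K)) (hν : ν = μ.map (fun p => (f p.1, G p)))
    (h1 : μ.toJordanDecomposition.posPart.fst ≪ m₁)
    (h2 : μ.toJordanDecomposition.negPart.fst ≪ m₁)
    (h3 : ν.toJordanDecomposition.posPart.fst ≪ m₁)
    (h4 : ν.toJordanDecomposition.negPart.fst ≪ m₁)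
    (C : ℝ) (hC : ∀ᵐ x ∂m₁, wNorm ζ (fiberS m₁ μ x) ≤ C)
    (g : K → ℝ) (hb : ∀ x, |g x| ≤ 1) (hh : ∀ x y, |g x - g y| ≤ dist x y ^ ζ) :
    ∀ᵐ x ∂m₁, sInt (fiberS m₁ ν x) g ≤ C := by
  have hg : Measurable g := (aux_cont hζ0 hh).measurable
  have hFm : Measurable (fun p : M × K => (f p.1, G p)) := (hf.comp measurable_fst).prodMk hG
  have i1 := (aux_disintS m₁ ν h3 h4 (h := fun p => g p.2) (hg.comp measurable_snd)
    (fun _ => hb _)).1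
  refine ae_le_of_forall_setIntegral_le i1 (integrable_const C) fun A hA _ => ?_
  have hind : Measurable (A.indicator (fun _ => (1 : ℝ))) := measurable_const.indicator hA
  have hind1 : ∀ x, A.indicator (fun _ => (1 : ℝ)) x = 0 ∨ A.indicator (fun _ => (1 : ℝ)) x = 1 :=
    fun x => by by_cases hx : x ∈ A <;> simp [hx]
  have hbb : ∀ x z, |A.indicator (fun _ => (1 : ℝ)) x * g z| ≤ 1 := fun x z => by
    rcases hind1 x with h | h <;> rw [h] <;> simp [hb]
  have hm1 : Measurable (fun p : M × K => A.indicator (fun _ => (1 : ℝ)) p.1 * g p.2) :=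
    (hind.comp measurable_fst).mul (hg.comp measurable_snd)
  have d1 := aux_disintS m₁ ν h3 h4 hm1 (fun p => hbb _ _)
  have d2 := aux_disintS m₁ μ h1 h2 (hm1.comp hFm) (fun p => hbb _ _)
  have e1 : sInt ν (fun p : M × K => A.indicator (fun _ => (1 : ℝ)) p.1 * g p.2) =
      sInt μ (fun p : M × K => A.indicator (fun _ => (1 : ℝ)) (f p.1) * g (G p)) := by
    rw [hν]
    exact aux_sInt_map μ hFm hm1 (fun p => hbb _ _)
  have e2 : ∫ x in A, sInt (fiberS m₁ ν x) g ∂m₁ =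
      ∫ x, sInt (fiberS m₁ ν x) (fun z => A.indicator (fun _ => (1 : ℝ)) x * g z) ∂m₁ := by
    rw [← integral_indicator hA]
    refine integral_congr_ae (Eventually.of_forall fun x => ?_)
    simp only [aux_sInt_const_mul]
    by_cases hx : x ∈ A <;> simp [hx]
  have e3 : ∫ x in A, C ∂m₁ = ∫ x, A.indicator (fun _ => (1 : ℝ)) (f x) * C ∂m₁ := by
    have : ∫ x, A.indicator (fun _ => (1 : ℝ)) (f x) * C ∂m₁ =
        ∫ x, A.indicator (fun _ => (1 : ℝ)) x * C ∂(m₁.map f) :=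
      (integral_map hf.aemeasurable (hind.mul_const C).aestronglyMeasurable).symm
    rw [this, hfinv, ← integral_indicator hA]
    refine integral_congr_ae (Eventually.of_forall fun x => ?_)
    by_cases hx : x ∈ A <;> simp [hx]
  rw [e2, d1.2, e1, e3]
  refine (le_of_eq d2.2.symm).trans ?_
  refine integral_mono_ae d2.1 ?_ ?_
  · refine Integrable.mul_const (aux_int m₁ (hind.comp hf) fun x => ?_) C
    show |A.indicator (fun _ => (1 : ℝ)) (f x)| ≤ 1
    rcases hind1 (f x) with h | h <;> rw [h] <;> simp
  · filter_upwards [hC, hGc] with x hx hGx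
    have : sInt (fiberS m₁ μ x) (fun z => g (G (x, z))) ≤ C := by
      refine (le_abs_self _).trans ((aux_le_wNorm ζ _ _ (fun z => hb _) fun y z => ?_).trans hx)
      exact (hh _ _).trans (Real.rpow_le_rpow dist_nonneg (hGx y z) hζ0.le)
    show sInt (fiberS m₁ μ x)
      (fun z => A.indicator (fun _ => (1 : ℝ)) (f x) * g (G (x, z))) ≤ _
    rw [aux_sInt_const_mul]
    refine mul_le_mul_of_nonneg_left this ?_
    rcases hind1 (f x) with h | h <;> rw [h] <;> simp

lemma aux_wNorm_le (ζ : ℝ) (hζ0 : 0 < ζ) (m₁ : Measure M)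
    (σ : M → SignedMeasure K) (C : ℝ)
    (H : ∀ g : K → ℝ, (∀ x, |g x| ≤ 1) → (∀ x y, |g x - g y| ≤ dist x y ^ ζ) →
      ∀ᵐ x ∂m₁, sInt (σ x) g ≤ C) :
    ∀ᵐ x ∂m₁, wNorm ζ (σ x) ≤ C := by
  let T : Set C(K, ℝ) := {g | (∀ x, |g x| ≤ 1) ∧ (∀ x y, |g x - g y| ≤ dist x y ^ ζ)}
  obtain ⟨D, hDc, hDd⟩ := TopologicalSpace.exists_countable_dense T
  have h1 : ∀ᵐ x ∂m₁, ∀ g ∈ D, sInt (σ x) g.1 ≤ C :=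
    (ae_ball_iff hDc).2 fun g _ => H _ g.2.1 g.2.2
  filter_upwards [h1] with x hx
  have h2 : ∀ g : T, sInt (σ x) g.1 ≤ C := by
    have hcl : IsClosed {g : T | sInt (σ x) g.1 ≤ C} :=
      isClosed_le ((aux_sInt_cont (σ x)).comp continuous_subtype_val) continuous_const
    intro g
    exact hcl.closure_subset_iff.2 hx (hDd g)
  have h3 : ∀ g : K → ℝ, (∀ x, |g x| ≤ 1) → (∀ x y, |g x - g y| ≤ dist x y ^ ζ) →
      sInt (σ x) g ≤ C := fun g hb hh => h2 ⟨⟨g, aux_cont hζ0 hh⟩, hb, hh⟩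
  refine csSup_le ⟨_, fun _ => 0, by simp, fun x y => by
    simpa using Real.rpow_nonneg dist_nonneg ζ, rfl⟩ ?_
  rintro r ⟨g, hb, hh, rfl⟩
  refine abs_le'.2 ⟨h3 g hb hh, ?_⟩
  have := aux_sInt_const_mul (σ x) (-1) g
  rw [neg_one_mul] at this
  rw [← this]
  refine h3 _ (fun z => by simpa using hb z) fun y z => ?_
  have := hh y z
  rw [← abs_neg] at this
  convert this using 2
  ring

end Aux

/-- **Weak contraction of the transfer operator in the `‖·‖_∞` norm.**
If `μ ∈ L^∞` then `F_*μ ∈ L^∞` and `‖F_*μ‖_∞ ≤ ‖μ‖_∞`. -/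
theorem transfer_weak_contraction_infNorm {M K : Type*}
    [MetricSpace M] [CompactSpace M] [MeasurableSpace M] [BorelSpace M]
    [MetricSpace K] [CompactSpace K] [MeasurableSpace K] [BorelSpace K]
    [StandardBorelSpace K] [Nonempty K]
    (ζ : ℝ) (hζ0 : 0 < ζ) (hζ1 : ζ ≤ 1)
    (hdM : Metric.diam (Set.univ : Set M) ≤ 1) (hdK : Metric.diam (Set.univ : Set K) ≤ 1)
    (m₁ : Measure M) [IsProbabilityMeasure m₁]
    (f : M → M) (hf : Measurable f) (hfinv : m₁.map f = m₁)
    (G : M × K → K) (hG : Measurable G)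
    (α : ℝ) (hα0 : 0 < α) (hα1 : α < 1)
    (hGc : ∀ᵐ x ∂m₁, ∀ z₁ z₂ : K, dist (G (x, z₁)) (G (x, z₂)) ≤ α * dist z₁ z₂)
    (F : M × K → M × K) (hF : ∀ p, F p = (f p.1, G p)) :
    ∀ μ : SignedMeasure (M × K), memLinf ζ m₁ μ →
      memLinf ζ m₁ (μ.map F) ∧ infNormE ζ m₁ (μ.map F) ≤ infNormE ζ m₁ μ := by
  intro μ hμ
  obtain ⟨h1, h2, h3⟩ := hμ
  have hFe : F = fun p => (f p.1, G p) := funext hF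
  have hFm : Measurable F := by
    rw [hFe]; exact (hf.comp measurable_fst).prodMk hG
  have hac : ∀ p : Measure (M × K), p.fst ≪ m₁ → (p.map F).fst ≪ m₁ := by
    intro p hp
    have : (p.map F).fst = p.fst.map f := by
      rw [Measure.fst, Measure.fst, Measure.map_map measurable_fst hFm,
        Measure.map_map hf measurable_fst]
      congr 1
      funext q
      simp [hF]
    rw [this]
    conv_rhs => rw [← hfinv]
    exact hp.map hf
  have hmap := aux_map μ hFm
  have hj := aux_jordan _ _ _ hmap
  have hs := (SignedMeasure.toJordanDecomposition (μ.map F)).mutuallySingular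
  have l1 := aux_le _ _ _ _ hs hj
  have l2 := aux_le _ _ _ _ hs.symm hj.symm
  have h4 : (SignedMeasure.toJordanDecomposition (μ.map F)).posPart.fst ≪ m₁ :=
    (Measure.absolutelyContinuous_of_le (Measure.map_mono l1 measurable_fst)).trans (hac _ h1)
  have h5 : (SignedMeasure.toJordanDecomposition (μ.map F)).negPart.fst ≪ m₁ :=
    (Measure.absolutelyContinuous_of_le (Measure.map_mono l2 measurable_fst)).trans (hac _ h2)
  have hC : ∀ᵐ x ∂m₁, wNorm ζ (fiberS m₁ μ x) ≤ (infNormE ζ m₁ μ).toReal := by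
    filter_upwards [ENNReal.ae_le_essSup
      (fun γ => ENNReal.ofReal (wNorm ζ (fiberS m₁ μ γ)))] with x hx
    exact (ENNReal.ofReal_le_iff_le_toReal h3.ne).1 hx
  have hGc' : ∀ᵐ x ∂m₁, ∀ z₁ z₂ : K, dist (G (x, z₁)) (G (x, z₂)) ≤ dist z₁ z₂ := by
    filter_upwards [hGc] with x hx z₁ z₂
    exact (hx z₁ z₂).trans (mul_le_of_le_one_left dist_nonneg hα1.le)
  have key := aux_wNorm_le ζ hζ0 m₁ (fun x => fiberS m₁ (μ.map F) x) (infNormE ζ m₁ μ).toReal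
    (fun g hb hh => aux_ae ζ hζ0 m₁ f hf hfinv G hG hGc' μ (μ.map F) (by rw [hFe]) h1 h2 h4 h5
      _ hC g hb hh)
  have hle : infNormE ζ m₁ (μ.map F) ≤ infNormE ζ m₁ μ := by
    refine essSup_le_of_ae_le _ ?_
    filter_upwards [key] with x hx
    exact (ENNReal.ofReal_le_iff_le_toReal h3.ne).2 hx
  exact ⟨⟨h4, h5, hle.trans_lt h3⟩, hle⟩
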